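/- arXiv:1710.03327 — 4 statements merged into one kernel-verified Lean document; each statement's English description precedes it below -/
import Mathlib

section
/- For each l = 1,…,d let ρ_l and μ_l be probability measures on ℝ, let π_l be a coupling of ρ_l and μ_l, and suppose there exist measurable functions φ_l, ψ_l : ℝ → ℝ, integrable with respect to ρ_l and μ_l respectively, such that φ_l(s) + ψ_l(t) ≤ (1/2)(s − t)² for all s,t ∈ ℝ and ∫ (1/2)(s − t)² dπ_l(s,t) = ∫ φ_l dρ_l + ∫ ψ_l dμ_l < ∞. Let π := ⊗_{l=1}^d π_l be the product coupling on ℝ^d × ℝ^d of ρ := ⊗_l ρ_l and μ := ⊗_l μ_l. Then π is an optimal plan for the quadratic cost: for every coupling γ of ρ and μ, ∫ (1/2)‖x − y‖² dπ(x,y) ≤ ∫ (1/2)‖x − y‖² dγ(x,y). -/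
open MeasureTheory

/-- The identification of `Fin d → ℝ` with Euclidean space `ℝ^d`. -/
noncomputable def toEuclidean' (d : ℕ) : (Fin d → ℝ) → EuclideanSpace ℝ (Fin d) :=
  fun v => (WithLp.equiv 2 (Fin d → ℝ)).symm v

lemma ofReal_integral_le_aux {α : Type*} [MeasurableSpace α] {m : Measure α} {F : α → ℝ}
    (hF : Integrable F m) :
    ENNReal.ofReal (∫ x, F x ∂m) ≤ ∫⁻ x, ENNReal.ofReal (F x) ∂m := by
  rw [integral_eq_lintegral_pos_part_sub_lintegral_neg_part hF]
  refine le_trans (ENNReal.ofReal_le_ofReal (sub_le_self _ ENNReal.toReal_nonneg)) ?_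
  exact ENNReal.ofReal_toReal_le

lemma measurable_toEuclidean_aux (d : ℕ) : Measurable (toEuclidean' d) :=
  (WithLp.measurable_toLp 2 (Fin d → ℝ))

lemma coord_preserving_aux (d : ℕ) (ρ : Fin d → Measure ℝ) [∀ l, IsProbabilityMeasure (ρ l)]
    (l : Fin d) :
    MeasurePreserving (fun x : EuclideanSpace ℝ (Fin d) => x l)
      ((Measure.pi ρ).map (toEuclidean' d)) (ρ l) := by
  refine ⟨by fun_prop, ?_⟩
  rw [Measure.map_map (by fun_prop) (measurable_toEuclidean_aux d)]
  exact (measurePreserving_eval ρ l).map_eq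

/-- if each `π l` is a coupling of `ρ l` and `μ l` that is optimal for the
one-dimensional quadratic cost, as witnessed by integrable dual functions `φ l`, `ψ l` with
zero duality gap, then the product coupling `⊗_l π l` (viewed on `ℝ^d × ℝ^d`) is an optimal
plan for the quadratic cost between the product measures: its cost is at most that of any
coupling `γ` of `⊗_l ρ l` and `⊗_l μ l` (integrals in the Lebesgue sense, possibly infinite
for `γ`). -/
theorem product_coupling_optimal (d : ℕ) (ρ μ : Fin d → Measure ℝ)
    [∀ l, IsProbabilityMeasure (ρ l)] [∀ l, IsProbabilityMeasure (μ l)]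
    (π : Fin d → Measure (ℝ × ℝ))
    (hπ1 : ∀ l, (π l).map Prod.fst = ρ l)
    (hπ2 : ∀ l, (π l).map Prod.snd = μ l)
    (φ ψ : Fin d → ℝ → ℝ)
    (hφm : ∀ l, Measurable (φ l)) (hψm : ∀ l, Measurable (ψ l))
    (hφi : ∀ l, Integrable (φ l) (ρ l)) (hψi : ∀ l, Integrable (ψ l) (μ l))
    (hdual : ∀ l s t, φ l s + ψ l t ≤ (1 / 2) * (s - t) ^ 2)
    (hcost : ∀ l, Integrable (fun st : ℝ × ℝ => (1 / 2) * (st.1 - st.2) ^ 2) (π l))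
    (hopt : ∀ l, ∫ st, (1 / 2) * (st.1 - st.2) ^ 2 ∂(π l)
        = ∫ s, φ l s ∂(ρ l) + ∫ t, ψ l t ∂(μ l)) :
    ∀ γ : Measure (EuclideanSpace ℝ (Fin d) × EuclideanSpace ℝ (Fin d)),
      γ.map Prod.fst = (Measure.pi ρ).map (toEuclidean' d) →
      γ.map Prod.snd = (Measure.pi μ).map (toEuclidean' d) →
      ∫⁻ z, ENNReal.ofReal ((1 / 2) * ‖z.1 - z.2‖ ^ 2)
          ∂((Measure.pi π).map (fun f : Fin d → ℝ × ℝ =>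
              (toEuclidean' d fun l => (f l).1, toEuclidean' d fun l => (f l).2)))
        ≤ ∫⁻ z, ENNReal.ofReal ((1 / 2) * ‖z.1 - z.2‖ ^ 2) ∂γ := by
  intro γ h1 h2
  have hP : ∀ l, IsProbabilityMeasure (π l) := fun l => by
    refine ⟨?_⟩
    have h : (π l).map Prod.fst Set.univ = 1 := by rw [hπ1 l]; exact measure_univ
    rwa [Measure.map_apply measurable_fst MeasurableSet.univ, Set.preimage_univ] at h
  have hm : Measurable (fun f : Fin d → ℝ × ℝ =>
      (toEuclidean' d fun l => (f l).1, toEuclidean' d fun l => (f l).2)) := by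
    refine Measurable.prodMk ((measurable_toEuclidean_aux d).comp ?_)
      ((measurable_toEuclidean_aux d).comp ?_) <;> fun_prop
  have hnorm : ∀ x y : EuclideanSpace ℝ (Fin d),
      (1 / 2) * ‖x - y‖ ^ 2 = ∑ l, (1 / 2) * (x l - y l) ^ 2 := by
    intro x y
    rw [EuclideanSpace.norm_sq_eq, Finset.mul_sum]
    simp [sq_abs]
  have e1 : ∀ l, MeasurePreserving (fun z : EuclideanSpace ℝ (Fin d) × EuclideanSpace ℝ (Fin d) =>
      z.1 l) γ (ρ l) := fun l =>
    (coord_preserving_aux d ρ l).comp ⟨measurable_fst, h1⟩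
  have e2 : ∀ l, MeasurePreserving (fun z : EuclideanSpace ℝ (Fin d) × EuclideanSpace ℝ (Fin d) =>
      z.2 l) γ (μ l) := fun l =>
    (coord_preserving_aux d μ l).comp ⟨measurable_snd, h2⟩
  have i1 : ∀ l, Integrable (fun z : EuclideanSpace ℝ (Fin d) × EuclideanSpace ℝ (Fin d) =>
      φ l (z.1 l)) γ := fun l => (e1 l).integrable_comp_of_integrable (hφi l)
  have i2 : ∀ l, Integrable (fun z : EuclideanSpace ℝ (Fin d) × EuclideanSpace ℝ (Fin d) =>
      ψ l (z.2 l)) γ := fun l => (e2 l).integrable_comp_of_integrable (hψi l)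
  have j1 : ∀ l, ∫ z, φ l (z.1 l) ∂γ = ∫ s, φ l s ∂(ρ l) := fun l => by
    rw [← (e1 l).map_eq, integral_map (e1 l).measurable.aemeasurable
      (hφm l).aestronglyMeasurable]
  have j2 : ∀ l, ∫ z, ψ l (z.2 l) ∂γ = ∫ s, ψ l s ∂(μ l) := fun l => by
    rw [← (e2 l).map_eq, integral_map (e2 l).measurable.aemeasurable
      (hψm l).aestronglyMeasurable]
  have hc : ∀ _ : Fin d, Measurable (fun st : ℝ × ℝ => (1 / 2) * (st.1 - st.2) ^ 2) := fun l => by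
    fun_prop
  have hleft : ∫⁻ z, ENNReal.ofReal ((1 / 2) * ‖z.1 - z.2‖ ^ 2)
          ∂((Measure.pi π).map (fun f : Fin d → ℝ × ℝ =>
              (toEuclidean' d fun l => (f l).1, toEuclidean' d fun l => (f l).2)))
      = ENNReal.ofReal (∑ l, (∫ s, φ l s ∂(ρ l) + ∫ t, ψ l t ∂(μ l))) := by
    rw [lintegral_map (by fun_prop) hm]
    have k : ∀ l, Integrable (fun f : Fin d → ℝ × ℝ => (1 / 2) * ((f l).1 - (f l).2) ^ 2)
        (Measure.pi π) := fun l =>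
      (measurePreserving_eval π l).integrable_comp_of_integrable (hcost l)
    simp only [hnorm]
    change ∫⁻ f : Fin d → ℝ × ℝ, ENNReal.ofReal (∑ l, (1 / 2) * ((f l).1 - (f l).2) ^ 2)
      ∂(Measure.pi π) = _
    rw [← ofReal_integral_eq_lintegral_ofReal (integrable_finsetSum _ fun l _ => k l)
      (Filter.Eventually.of_forall fun f => Finset.sum_nonneg fun l _ => by positivity),
      integral_finsetSum _ fun l _ => k l]
    congr 1
    refine Finset.sum_congr rfl fun l _ => ?_
    rw [← hopt l]
    conv_rhs => rw [← (measurePreserving_eval π l).map_eq,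
      integral_map (measurePreserving_eval π l).measurable.aemeasurable
        (hc l).aestronglyMeasurable]
  rw [hleft]
  have hF : Integrable (fun z : EuclideanSpace ℝ (Fin d) × EuclideanSpace ℝ (Fin d) =>
      ∑ l, (φ l (z.1 l) + ψ l (z.2 l))) γ :=
    integrable_finsetSum _ fun l _ => (i1 l).add (i2 l)
  have hval : ∫ z, ∑ l, (φ l (z.1 l) + ψ l (z.2 l)) ∂γ
      = ∑ l, (∫ s, φ l s ∂(ρ l) + ∫ t, ψ l t ∂(μ l)) := by
    refine (integral_finsetSum _ fun l _ => (i1 l).add (i2 l)).trans ?_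
    refine Finset.sum_congr rfl fun l _ => ?_
    rw [← j1 l, ← j2 l]
    exact integral_add (i1 l) (i2 l)
  rw [← hval]
  refine (ofReal_integral_le_aux hF).trans (lintegral_mono fun z => ?_)
  refine ENNReal.ofReal_le_ofReal ?_
  rw [hnorm]
  exact Finset.sum_le_sum fun l _ => hdual l _ _
end

section
/- Under the hypotheses of the factorized optimal transport theorem — for each l = 1,…,d, ρ_l and μ_l are probability measures on ℝ, π_l is a coupling of ρ_l and μ_l with per-coordinate optimal cost C_l := ∫ (1/2)(s − t)² dπ_l(s,t) < ∞, and there exist integrable dual functions φ_l, ψ_l with φ_l(s) + ψ_l(t) ≤ (1/2)(s − t)² for all s,t and C_l = ∫ φ_l dρ_l + ∫ ψ_l dμ_l — the optimal value of the quadratic-cost transport problem between ρ := ⊗_l ρ_l and μ := ⊗_l μ_l equals the sum of the one-dimensional optimal values: the infimum over all couplings γ of ρ and μ of ∫ (1/2)‖x − y‖² dγ equals ∑_{l=1}^d C_l. -/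
open MeasureTheory

/-- under the hypotheses of the factorized optimal transport theorem (each
`π l` is a coupling of `ρ l` and `μ l` with finite per-coordinate optimal cost
`C l = ∫ (1/2)(s−t)² dπ l`, witnessed optimal by integrable dual functions with zero duality
gap), the optimal value of the quadratic-cost transport problem between the product measures
equals the sum of the one-dimensional optimal values: the infimum over couplings `γ` of the
(possibly infinite) cost `∫ (1/2)‖x−y‖² dγ` equals `∑ l, C l`. -/
theorem optimal_value_is_sum (d : ℕ) (ρ μ : Fin d → Measure ℝ)
    [∀ l, IsProbabilityMeasure (ρ l)] [∀ l, IsProbabilityMeasure (μ l)]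
    (π : Fin d → Measure (ℝ × ℝ))
    (hπ1 : ∀ l, (π l).map Prod.fst = ρ l)
    (hπ2 : ∀ l, (π l).map Prod.snd = μ l)
    (C : Fin d → ℝ)
    (hC : ∀ l, C l = ∫ st, (1 / 2) * (st.1 - st.2) ^ 2 ∂(π l))
    (hcost : ∀ l, Integrable (fun st : ℝ × ℝ => (1 / 2) * (st.1 - st.2) ^ 2) (π l))
    (φ ψ : Fin d → ℝ → ℝ)
    (hφm : ∀ l, Measurable (φ l)) (hψm : ∀ l, Measurable (ψ l))
    (hφi : ∀ l, Integrable (φ l) (ρ l)) (hψi : ∀ l, Integrable (ψ l) (μ l))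
    (hdual : ∀ l s t, φ l s + ψ l t ≤ (1 / 2) * (s - t) ^ 2)
    (hopt : ∀ l, C l = ∫ s, φ l s ∂(ρ l) + ∫ t, ψ l t ∂(μ l)) :
    (⨅ γ : {γ : Measure (EuclideanSpace ℝ (Fin d) × EuclideanSpace ℝ (Fin d)) //
        γ.map Prod.fst = (Measure.pi ρ).map (toEuclidean' d) ∧
        γ.map Prod.snd = (Measure.pi μ).map (toEuclidean' d)},
      ∫⁻ z, ENNReal.ofReal ((1 / 2) * ‖z.1 - z.2‖ ^ 2) ∂γ.1)
      = ENNReal.ofReal (∑ l, C l) := by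
  classical
  have hπp : ∀ l, IsProbabilityMeasure (π l) := by
    intro l
    constructor
    have h : (π l).map Prod.fst Set.univ = 1 := by rw [hπ1 l]; simp
    rwa [Measure.map_apply measurable_fst MeasurableSet.univ, Set.preimage_univ] at h
  have hmE : Measurable (toEuclidean' d) := by
    unfold toEuclidean'
    exact (WithLp.measurable_toLp 2 (Fin d → ℝ))
  have hnorm : ∀ x y : EuclideanSpace ℝ (Fin d),
      (1 / 2) * ‖x - y‖ ^ 2 = ∑ l, (1 / 2) * (x l - y l) ^ 2 := by
    intro x y
    rw [EuclideanSpace.norm_sq_eq, Finset.mul_sum]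
    simp
  have hcoord : ∀ l, Measurable (fun x : EuclideanSpace ℝ (Fin d) => x l) := by
    intro l
    fun_prop
  apply le_antisymm
  · let T : (Fin d → ℝ × ℝ) → EuclideanSpace ℝ (Fin d) × EuclideanSpace ℝ (Fin d) :=
      fun p => (toEuclidean' d (fun i => (p i).1), toEuclidean' d (fun i => (p i).2))
    have hT : Measurable T := by
      apply Measurable.prodMk
      · exact hmE.comp (by fun_prop)
      · exact hmE.comp (by fun_prop)
    have h1 : ((Measure.pi π).map T).map Prod.fst = (Measure.pi ρ).map (toEuclidean' d) := by
      have e : Measure.pi ρ = (Measure.pi π).map (fun p i => (p i).1) := by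
        have hi : ∀ i, IsProbabilityMeasure ((π i).map Prod.fst) := by
          intro i; rw [hπ1]; infer_instance
        rw [Measure.pi_map_pi (fun i => measurable_fst.aemeasurable)]
        simp only [hπ1]
      rw [e, Measure.map_map measurable_fst hT, Measure.map_map hmE (by fun_prop)]
      rfl
    have h2 : ((Measure.pi π).map T).map Prod.snd = (Measure.pi μ).map (toEuclidean' d) := by
      have e : Measure.pi μ = (Measure.pi π).map (fun p i => (p i).2) := by
        have hi : ∀ i, IsProbabilityMeasure ((π i).map Prod.snd) := by
          intro i; rw [hπ2]; infer_instance
        rw [Measure.pi_map_pi (fun i => measurable_snd.aemeasurable)]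
        simp only [hπ2]
      rw [e, Measure.map_map measurable_snd hT, Measure.map_map hmE (by fun_prop)]
      rfl
    refine (iInf_le _ ⟨(Measure.pi π).map T, h1, h2⟩).trans (le_of_eq ?_)
    show ∫⁻ z, ENNReal.ofReal ((1 / 2) * ‖z.1 - z.2‖ ^ 2) ∂((Measure.pi π).map T) = _
    rw [lintegral_map (by fun_prop) hT]
    have e : ∀ p : Fin d → ℝ × ℝ, ENNReal.ofReal ((1 / 2) * ‖(T p).1 - (T p).2‖ ^ 2)
        = ∑ l, ENNReal.ofReal ((1 / 2) * ((p l).1 - (p l).2) ^ 2) := by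
      intro p
      rw [hnorm, ENNReal.ofReal_sum_of_nonneg (fun _ _ => by positivity)]
      rfl
    simp_rw [e]
    rw [lintegral_finsetSum _ (fun l _ => by fun_prop),
      ENNReal.ofReal_sum_of_nonneg
        (fun l _ => by rw [hC l]; exact integral_nonneg (fun _ => by positivity))]
    refine Finset.sum_congr rfl (fun l _ => ?_)
    rw [hC l, ofReal_integral_eq_lintegral_ofReal (hcost l)
      (Filter.Eventually.of_forall (fun _ => by positivity))]
    exact (measurePreserving_eval π l).lintegral_comp
      (f := fun q : ℝ × ℝ => ENNReal.ofReal ((1 / 2) * (q.1 - q.2) ^ 2)) (by fun_prop)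
  · refine le_iInf ?_
    rintro ⟨γ, h1, h2⟩
    show _ ≤ ∫⁻ z, ENNReal.ofReal ((1 / 2) * ‖z.1 - z.2‖ ^ 2) ∂γ
    have p1 : ∀ l, MeasurePreserving (fun z : EuclideanSpace ℝ (Fin d) ×
        EuclideanSpace ℝ (Fin d) => z.1 l) γ (ρ l) := by
      intro l
      refine ⟨(hcoord l).comp measurable_fst, ?_⟩
      rw [← (measurePreserving_eval ρ l).map_eq]
      have := congrArg (Measure.map (fun x : EuclideanSpace ℝ (Fin d) => x l)) h1
      rw [Measure.map_map (hcoord l) measurable_fst, Measure.map_map (hcoord l) hmE] at this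
      exact this
    have p2 : ∀ l, MeasurePreserving (fun z : EuclideanSpace ℝ (Fin d) ×
        EuclideanSpace ℝ (Fin d) => z.2 l) γ (μ l) := by
      intro l
      refine ⟨(hcoord l).comp measurable_snd, ?_⟩
      rw [← (measurePreserving_eval μ l).map_eq]
      have := congrArg (Measure.map (fun x : EuclideanSpace ℝ (Fin d) => x l)) h2
      rw [Measure.map_map (hcoord l) measurable_snd, Measure.map_map (hcoord l) hmE] at this
      exact this
    have i1 : ∀ l, Integrable (fun z : EuclideanSpace ℝ (Fin d) ×
        EuclideanSpace ℝ (Fin d) => φ l (z.1 l)) γ :=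
      fun l => (p1 l).integrable_comp_of_integrable (hφi l)
    have i2 : ∀ l, Integrable (fun z : EuclideanSpace ℝ (Fin d) ×
        EuclideanSpace ℝ (Fin d) => ψ l (z.2 l)) γ :=
      fun l => (p2 l).integrable_comp_of_integrable (hψi l)
    have e1 : ∀ l, ∫ z, φ l (z.1 l) ∂γ = ∫ s, φ l s ∂(ρ l) := by
      intro l
      rw [← (p1 l).map_eq, integral_map (p1 l).measurable.aemeasurable
        (hφm l).aestronglyMeasurable]
    have e2 : ∀ l, ∫ z, ψ l (z.2 l) ∂γ = ∫ s, ψ l s ∂(μ l) := by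
      intro l
      rw [← (p2 l).map_eq, integral_map (p2 l).measurable.aemeasurable
        (hψm l).aestronglyMeasurable]
    have iF : Integrable (fun z : EuclideanSpace ℝ (Fin d) × EuclideanSpace ℝ (Fin d) =>
        ∑ l, (φ l (z.1 l) + ψ l (z.2 l))) γ :=
      integrable_finsetSum _ (fun l _ => (i1 l).add (i2 l))
    have eF : ∑ l, C l = ∫ z, ∑ l, (φ l (z.1 l) + ψ l (z.2 l)) ∂γ := by
      rw [integral_finsetSum Finset.univ
        (f := fun l (z : EuclideanSpace ℝ (Fin d) × EuclideanSpace ℝ (Fin d)) =>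
          φ l (z.1 l) + ψ l (z.2 l)) (fun l _ => (i1 l).add (i2 l))]
      refine Finset.sum_congr rfl (fun l _ => ?_)
      rw [integral_add (i1 l) (i2 l), e1, e2, hopt]
    have step : ENNReal.ofReal (∑ l, C l) ≤
        ∫⁻ z, ENNReal.ofReal (∑ l, (φ l (z.1 l) + ψ l (z.2 l))) ∂γ := by
      apply ENNReal.ofReal_le_of_le_toReal
      rw [eF, integral_eq_lintegral_pos_part_sub_lintegral_neg_part iF]
      exact sub_le_self _ ENNReal.toReal_nonneg
    refine step.trans (lintegral_mono (fun z => ENNReal.ofReal_le_ofReal ?_))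
    rw [hnorm]
    exact Finset.sum_le_sum (fun l _ => hdual l _ _)
end

section
/- Under the hypotheses of the factorized optimal transport theorem — for each l = 1,…,d, ρ_l and μ_l are probability measures on ℝ, π_l is a coupling of ρ_l and μ_l, and φ_l, ψ_l are integrable dual functions satisfying φ_l(s) + ψ_l(t) ≤ (1/2)(s − t)² for all s,t and ∫ (1/2)(s − t)² dπ_l = ∫ φ_l dρ_l + ∫ ψ_l dμ_l < ∞ — the functions φ(x) := ∑_l φ_l(x_l) and ψ(y) := ∑_l ψ_l(y_l) are optimal for the dual problem of the quadratic-cost transport between ρ := ⊗_l ρ_l and μ := ⊗_l μ_l: for every pair of integrable measurable functions φ', ψ' with φ'(x) + ψ'(y) ≤ (1/2)‖x − y‖² for all x, y ∈ ℝ^d, one has ∫ φ' dρ + ∫ ψ' dμ ≤ ∫ φ dρ + ∫ ψ dμ. -/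
open MeasureTheory

/-- under the hypotheses of the factorized optimal transport theorem, the sums
`φ(x) = ∑ l, φ l (x l)` and `ψ(y) = ∑ l, ψ l (y l)` are optimal for the dual problem of the
quadratic-cost transport between the product measures `ρ = ⊗_l ρ l` and `μ = ⊗_l μ l`:
they dominate every integrable dual-feasible pair `(φ', ψ')`. -/
theorem sum_duals_optimal (d : ℕ) (ρ μ : Fin d → Measure ℝ)
    [∀ l, IsProbabilityMeasure (ρ l)] [∀ l, IsProbabilityMeasure (μ l)]
    (π : Fin d → Measure (ℝ × ℝ))
    (hπ1 : ∀ l, (π l).map Prod.fst = ρ l)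
    (hπ2 : ∀ l, (π l).map Prod.snd = μ l)
    (φ ψ : Fin d → ℝ → ℝ)
    (hφm : ∀ l, Measurable (φ l)) (hψm : ∀ l, Measurable (ψ l))
    (hφi : ∀ l, Integrable (φ l) (ρ l)) (hψi : ∀ l, Integrable (ψ l) (μ l))
    (hdual : ∀ l s t, φ l s + ψ l t ≤ (1 / 2) * (s - t) ^ 2)
    (hcost : ∀ l, Integrable (fun st : ℝ × ℝ => (1 / 2) * (st.1 - st.2) ^ 2) (π l))
    (hopt : ∀ l, ∫ st, (1 / 2) * (st.1 - st.2) ^ 2 ∂(π l)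
        = ∫ s, φ l s ∂(ρ l) + ∫ t, ψ l t ∂(μ l)) :
    ∀ (φ' ψ' : EuclideanSpace ℝ (Fin d) → ℝ),
      Measurable φ' → Measurable ψ' →
      Integrable φ' ((Measure.pi ρ).map (toEuclidean' d)) →
      Integrable ψ' ((Measure.pi μ).map (toEuclidean' d)) →
      (∀ x y : EuclideanSpace ℝ (Fin d), φ' x + ψ' y ≤ (1 / 2) * ‖x - y‖ ^ 2) →
      ∫ x, φ' x ∂((Measure.pi ρ).map (toEuclidean' d))
          + ∫ y, ψ' y ∂((Measure.pi μ).map (toEuclidean' d))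
        ≤ ∫ x, (∑ l, φ l (x l)) ∂((Measure.pi ρ).map (toEuclidean' d))
          + ∫ y, (∑ l, ψ l (y l)) ∂((Measure.pi μ).map (toEuclidean' d)) := by
  intro φ' ψ' hφ'm hψ'm hφ'i hψ'i hfeas
  have hπp : ∀ l, IsProbabilityMeasure (π l) := fun l => by
    have h : IsProbabilityMeasure ((π l).map Prod.fst) := by rw [hπ1 l]; infer_instance
    exact Measure.isProbabilityMeasure_of_map (μ := π l) Prod.fst
  have hT : Measurable (toEuclidean' d) := WithLp.measurable_toLp 2 _
  have hX : MeasurePreserving (fun (z : Fin d → ℝ × ℝ) (l : Fin d) => (z l).1)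
      (Measure.pi π) (Measure.pi ρ) :=
    measurePreserving_pi π ρ (fun l => ⟨measurable_fst, hπ1 l⟩)
  have hY : MeasurePreserving (fun (z : Fin d → ℝ × ℝ) (l : Fin d) => (z l).2)
      (Measure.pi π) (Measure.pi μ) :=
    measurePreserving_pi π μ (fun l => ⟨measurable_snd, hπ2 l⟩)
  have hTX : MeasurePreserving (fun z : Fin d → ℝ × ℝ => toEuclidean' d (fun l => (z l).1))
      (Measure.pi π) ((Measure.pi ρ).map (toEuclidean' d)) :=
    (MeasurePreserving.mk hT rfl).comp hX
  have hTY : MeasurePreserving (fun z : Fin d → ℝ × ℝ => toEuclidean' d (fun l => (z l).2))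
      (Measure.pi π) ((Measure.pi μ).map (toEuclidean' d)) :=
    (MeasurePreserving.mk hT rfl).comp hY
  have key : ∀ (ν : Fin d → Measure ℝ) [∀ l, IsProbabilityMeasure (ν l)] (f : Fin d → ℝ → ℝ),
      (∀ l, Measurable (f l)) → (∀ l, Integrable (f l) (ν l)) →
      ∫ x, (∑ l, f l (x l)) ∂((Measure.pi ν).map (toEuclidean' d)) = ∑ l, ∫ s, f l s ∂(ν l) := by
    intro ν _ f hfm hfi
    have hm : Measurable (fun x : EuclideanSpace ℝ (Fin d) => ∑ l, f l (x l)) := by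
      refine Finset.measurable_sum _ (fun l _ => (hfm l).comp ?_)
      fun_prop
    rw [integral_map hT.aemeasurable hm.aestronglyMeasurable]
    change ∫ x : Fin d → ℝ, (∑ l, f l (x l)) ∂(Measure.pi ν) = _
    rw [integral_finsetSum _ (fun l _ => integrable_comp_eval (hfi l))]
    exact Finset.sum_congr rfl
      (fun l _ => integral_comp_eval (hfm l).aestronglyMeasurable)
  rw [key ρ φ hφm hφi, key μ ψ hψm hψi, ← Finset.sum_add_distrib]
  simp_rw [← hopt]
  have e1 : ∫ x, φ' x ∂((Measure.pi ρ).map (toEuclidean' d))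
      = ∫ z, φ' (toEuclidean' d (fun l => (z l).1)) ∂(Measure.pi π) := by
    rw [← hTX.map_eq, integral_map hTX.measurable.aemeasurable hφ'm.aestronglyMeasurable]
  have e2 : ∫ x, ψ' x ∂((Measure.pi μ).map (toEuclidean' d))
      = ∫ z, ψ' (toEuclidean' d (fun l => (z l).2)) ∂(Measure.pi π) := by
    rw [← hTY.map_eq, integral_map hTY.measurable.aemeasurable hψ'm.aestronglyMeasurable]
  have i1 := hTX.integrable_comp_of_integrable hφ'i
  have i2 := hTY.integrable_comp_of_integrable hψ'i
  have i3 : ∀ l, Integrable (fun z : Fin d → ℝ × ℝ => (1 / 2) * ((z l).1 - (z l).2) ^ 2)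
      (Measure.pi π) := fun l => 
      integrable_comp_eval (X := fun _ : Fin d => ℝ × ℝ) (μ := π) (i := l)
        (f := fun st : ℝ × ℝ => (1 / 2) * (st.1 - st.2) ^ 2) (hcost l)
  have e3 : ∑ l, ∫ st, (1 / 2) * (st.1 - st.2) ^ 2 ∂(π l)
      = ∫ z : Fin d → ℝ × ℝ, (∑ l, (1 / 2) * ((z l).1 - (z l).2) ^ 2) ∂(Measure.pi π) := by
    rw [integral_finsetSum _ (fun l _ => i3 l)]
    exact Finset.sum_congr rfl
      (fun l _ => (integral_comp_eval (X := fun _ : Fin d => ℝ × ℝ) (μ := π) (i := l)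
        (f := fun st : ℝ × ℝ => (1 / 2) * (st.1 - st.2) ^ 2)
        (hcost l).aestronglyMeasurable).symm)
  rw [e1, e2, e3]
  refine (integral_add i1 i2).symm.le.trans ?_
  refine integral_mono (i1.add i2) (integrable_finsetSum _ fun l _ => i3 l) (fun z => ?_)
  refine (hfeas _ _).trans (le_of_eq ?_)
  rw [EuclideanSpace.norm_sq_eq, Finset.mul_sum]
  refine Finset.sum_congr rfl (fun l _ => ?_)
  rw [Real.norm_eq_abs, sq_abs]
  rfl
end

section
/- Let H, K be finite index sets (coarse cells) and I, J finite index sets (fine cells), with parent maps h : I → H and k : J → K. Let p : I → ℝ and q : J → ℝ be nonnegative, and set P_h := ∑_{i : h(i)=h} p_i and Q_k := ∑_{j : k(j)=k} q_j; assume P_h > 0 for all h ∈ H and Q_k > 0 for all k ∈ K. Let Λ : H × K → ℝ be a feasible coarse solution, i.e. Λ^{hk} ≥ 0 with ∑_k Λ^{hk} = P_h for every h and ∑_h Λ^{hk} = Q_k for every k. Define λ^{ij} := p_i q_j Λ^{h(i)k(j)} / (P_{h(i)} Q_{k(j)}). Then λ^{ij} ≥ 0, ∑_j λ^{ij} = p_i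 for every i ∈ I, ∑_i λ^{ij} = q_j for every j ∈ J, and λ^{ij} = 0 whenever Λ^{h(i)k(j)} = 0. In particular the refined transportation system is feasible with support contained in the set of pairs whose parent pairs carry nonzero coarse mass. -/
open Finset

/-- Summing over fine cells by grouping them by their coarse parent. -/
theorem sum_fibers_aux {J K : Type*} [Fintype J] [Fintype K] [DecidableEq K]
    (k : J → K) (q : J → ℝ) (Q : K → ℝ)
    (hQ : ∀ b, Q b = ∑ j ∈ univ.filter (fun j => k j = b), q j) (f : K → ℝ) :
    ∑ j, q j * f (k j) = ∑ b, Q b * f b := by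
  rw [← Finset.sum_fiberwise univ k]
  refine Finset.sum_congr rfl fun b _ => ?_
  rw [hQ, Finset.sum_mul]
  refine Finset.sum_congr rfl fun j hj => ?_
  rw [(Finset.mem_filter.mp hj).2]

/-- refinement feasibility: given parent maps `h : I → H`, `k : J → K`,
nonnegative fine weights `p`, `q` whose sums over the children of each coarse cell give the
(positive) coarse weights `P`, `Q`, and a feasible coarse solution `Λ`, the refined weights
`λ^{ij} = p i * q j * Λ^{h(i) k(j)} / (P (h i) * Q (k j))` are nonnegative, have row sums
`p i` and column sums `q j`, and vanish whenever the parent entry `Λ^{h(i) k(j)}` vanishes. -/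
theorem refined_transportation_feasible
    {H K I J : Type*} [Fintype H] [Fintype K] [Fintype I] [Fintype J]
    [DecidableEq H] [DecidableEq K]
    (h : I → H) (k : J → K) (p : I → ℝ) (q : J → ℝ)
    (hp : ∀ i, 0 ≤ p i) (hq : ∀ j, 0 ≤ q j)
    (P : H → ℝ) (Q : K → ℝ)
    (hP : ∀ a, P a = ∑ i ∈ univ.filter (fun i => h i = a), p i)
    (hQ : ∀ b, Q b = ∑ j ∈ univ.filter (fun j => k j = b), q j)
    (hPpos : ∀ a, 0 < P a) (hQpos : ∀ b, 0 < Q b)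
    (Λ : H → K → ℝ) (hΛ0 : ∀ a b, 0 ≤ Λ a b)
    (hΛrow : ∀ a, ∑ b, Λ a b = P a) (hΛcol : ∀ b, ∑ a, Λ a b = Q b) :
    (∀ i j, 0 ≤ p i * q j * Λ (h i) (k j) / (P (h i) * Q (k j))) ∧
    (∀ i, ∑ j, p i * q j * Λ (h i) (k j) / (P (h i) * Q (k j)) = p i) ∧
    (∀ j, ∑ i, p i * q j * Λ (h i) (k j) / (P (h i) * Q (k j)) = q j) ∧
    (∀ i j, Λ (h i) (k j) = 0 → p i * q j * Λ (h i) (k j) / (P (h i) * Q (k j)) = 0) := by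
  refine ⟨fun i j => ?_, fun i => ?_, fun j => ?_, fun i j h0 => by simp [h0]⟩
  · exact div_nonneg (mul_nonneg (mul_nonneg (hp i) (hq j)) (hΛ0 _ _))
      (mul_pos (hPpos _) (hQpos _)).le
  · have e : ∀ j, p i * q j * Λ (h i) (k j) / (P (h i) * Q (k j))
        = p i / P (h i) * (q j * (Λ (h i) (k j) / Q (k j))) := by
      intro j
      have h1 := (hPpos (h i)).ne'
      have h2 := (hQpos (k j)).ne'
      field_simp
    simp_rw [e]
    rw [← Finset.mul_sum, sum_fibers_aux k q Q hQ (fun b => Λ (h i) b / Q b)]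
    have e2 : ∀ b, Q b * (Λ (h i) b / Q b) = Λ (h i) b :=
      fun b => by rw [mul_comm, div_mul_cancel₀ _ (hQpos b).ne']
    simp_rw [e2]
    rw [hΛrow, div_mul_cancel₀ _ (hPpos _).ne']
  · have e : ∀ i, p i * q j * Λ (h i) (k j) / (P (h i) * Q (k j))
        = q j / Q (k j) * (p i * (Λ (h i) (k j) / P (h i))) := by
      intro i
      have h1 := (hPpos (h i)).ne'
      have h2 := (hQpos (k j)).ne'
      field_simp
    simp_rw [e]
    rw [← Finset.mul_sum, sum_fibers_aux h p P hP (fun a => Λ a (k j) / P a)]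
    have e2 : ∀ a, P a * (Λ a (k j) / P a) = Λ a (k j) :=
      fun a => by rw [mul_comm, div_mul_cancel₀ _ (hPpos a).ne']
    simp_rw [e2]
    rw [hΛcol, div_mul_cancel₀ _ (hQpos _).ne']
end
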